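/- Fix real numbers x2, x3, y1, y2, y3. Then for every real x1 with X ≠ 0 (where X := x1 − y1), setting Y := x2 − y2, Z := x3 − y3 and R := sqrt(X² + Y² + Z²), the function x1 ↦ X·atan((Y/R)·(Z/X)) − Y·atanh(Z/R) − Z·atanh(Y/R) has derivative atan((Y/R)·(Z/X)) at x1. -/

import Mathlib

/-- The real inverse hyperbolic tangent. -/
noncomputable def atanh (x : ℝ) : ℝ := Real.log ((1 + x) / (1 - x)) / 2

theorem hasDerivAt_atanh_aux {u : ℝ} (hu : u ^ 2 < 1) : HasDerivAt atanh (1 / (1 - u ^ 2)) u := by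
  have h1 : 0 < 1 + u := by nlinarith
  have h2 : 0 < 1 - u := by nlinarith
  have h3 : 1 - u ^ 2 ≠ 0 := by nlinarith
  have ha : HasDerivAt (fun x : ℝ => 1 + x) 1 u := (hasDerivAt_id u).const_add 1
  have hb : HasDerivAt (fun x : ℝ => 1 - x) (-1) u := (hasDerivAt_id u).const_sub 1
  have := ((ha.div hb h2.ne').log (div_pos h1 h2).ne').div_const 2
  refine this.congr_deriv ?_
  have e : 1 - u ^ 2 = (1 + u) * (1 - u) := by ring
  rw [e]
  simp only [Pi.div_apply]
  field_simp
  ring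

theorem stmt_aux (Y Z y1 x1 : ℝ) (h : x1 - y1 ≠ 0) :
    HasDerivAt (fun t : ℝ =>
        (t - y1) * Real.arctan (Y / Real.sqrt ((t - y1) ^ 2 + Y ^ 2 + Z ^ 2) * (Z / (t - y1)))
          - Y * atanh (Z / Real.sqrt ((t - y1) ^ 2 + Y ^ 2 + Z ^ 2))
          - Z * atanh (Y / Real.sqrt ((t - y1) ^ 2 + Y ^ 2 + Z ^ 2)))
      (Real.arctan (Y / Real.sqrt ((x1 - y1) ^ 2 + Y ^ 2 + Z ^ 2) * (Z / (x1 - y1)))) x1 := by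
  have hX : HasDerivAt (fun t : ℝ => t - y1) 1 x1 := (hasDerivAt_id x1).sub_const y1
  have hX2 : 0 < (x1 - y1) ^ 2 := by positivity
  have hS : 0 < (x1 - y1) ^ 2 + Y ^ 2 + Z ^ 2 := by positivity
  have hR := (((hX.pow 2).add_const (Y ^ 2)).add_const (Z ^ 2)).sqrt hS.ne'
  have hRpos := Real.sqrt_pos.2 hS
  have hRsq := Real.sq_sqrt hS.le
  have hYR := (hasDerivAt_const x1 Y).div hR hRpos.ne'
  have hZR := (hasDerivAt_const x1 Z).div hR hRpos.ne'
  have hZX := (hasDerivAt_const x1 Z).div hX h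
  have hy1 : (Y / Real.sqrt ((x1 - y1) ^ 2 + Y ^ 2 + Z ^ 2)) ^ 2 < 1 := by
    rw [div_pow, hRsq, div_lt_one hS]; nlinarith [sq_nonneg Z]
  have hz1 : (Z / Real.sqrt ((x1 - y1) ^ 2 + Y ^ 2 + Z ^ 2)) ^ 2 < 1 := by
    rw [div_pow, hRsq, div_lt_one hS]; nlinarith [sq_nonneg Y]
  have hA := hX.mul (hYR.mul hZX).arctan
  have hB := (HasDerivAt.comp x1 (hasDerivAt_atanh_aux hz1) hZR).const_mul Y
  have hC := (HasDerivAt.comp x1 (hasDerivAt_atanh_aux hy1) hYR).const_mul Z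
  refine ((hA.sub hB).sub hC).congr_deriv ?_
  simp only [Pi.div_apply, Pi.mul_apply, Pi.pow_apply]
  generalize hr : Real.sqrt ((x1 - y1) ^ 2 + Y ^ 2 + Z ^ 2) = R at *
  generalize x1 - y1 = X at *
  have e1 : 1 - (Z / R) ^ 2 = (X ^ 2 + Y ^ 2) / R ^ 2 := by
    field_simp; linarith
  have e2 : 1 - (Y / R) ^ 2 = (X ^ 2 + Z ^ 2) / R ^ 2 := by
    field_simp; linarith
  have e3 : 1 + (Y / R * (Z / X)) ^ 2 = (X ^ 2 + Y ^ 2) * (X ^ 2 + Z ^ 2) / (R ^ 2 * X ^ 2) := by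
    field_simp; rw [hRsq]; ring
  rw [e1, e2, e3]
  have p1 : X ^ 2 + Y ^ 2 ≠ 0 := by positivity
  have p2 : X ^ 2 + Z ^ 2 ≠ 0 := by positivity
  have hR0 := hRpos.ne'
  rw [one_mul, sub_sub, add_sub_assoc, add_eq_left]
  push_cast
  field_simp
  ring_nf
  have h4 : R ^ 2 = X ^ 2 + Y ^ 2 + Z ^ 2 := hRsq
  simp only [h4]
  ring

theorem stmt_7 (x2 x3 y1 y2 y3 : ℝ) (x1 : ℝ) (h : x1 - y1 ≠ 0) :
    HasDerivAt (fun t : ℝ =>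
        (t - y1) * Real.arctan
            ((x2 - y2) / Real.sqrt ((t - y1) ^ 2 + (x2 - y2) ^ 2 + (x3 - y3) ^ 2)
              * ((x3 - y3) / (t - y1)))
          - (x2 - y2) * atanh ((x3 - y3) / Real.sqrt ((t - y1) ^ 2 + (x2 - y2) ^ 2 + (x3 - y3) ^ 2))
          - (x3 - y3) * atanh ((x2 - y2) / Real.sqrt ((t - y1) ^ 2 + (x2 - y2) ^ 2 + (x3 - y3) ^ 2)))
      (Real.arctan
        ((x2 - y2) / Real.sqrt ((x1 - y1) ^ 2 + (x2 - y2) ^ 2 + (x3 - y3) ^ 2)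
          * ((x3 - y3) / (x1 - y1)))) x1 := by
  exact stmt_aux (x2 - y2) (x3 - y3) y1 x1 h
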